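/- There is a constant C≥1, independent of the word and the point, such that for every finite word 𝔦∈𝓘* and every a∈[0,1]², the larger singular value of the Jacobian satisfies C⁻¹·f_{𝔦,x}(a) ≤ α₁(D_aS_𝔦) ≤ C·f_{𝔦,x}(a). -/

import Mathlib

/-!
Setting (Falconer–Fraser–Lee, "L^q-spectra of measures on planar non-conformal attractors"):
a finite family of C^{1+α} skew-product contractions
`S i (x,y) = (f i x, g i (x,y))` of the unit square, satisfying a domination
condition on the (lower triangular) Jacobians.
-/

open Set Filter Topology MeasureTheory
open scoped Classical ENNReal

noncomputable section

/-- The closed unit square `[0,1]² ⊆ ℝ²`. -/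
def unitSq : Set (ℝ × ℝ) := Set.Icc (0:ℝ) 1 ×ˢ Set.Icc (0:ℝ) 1

variable {ι : Type*} [Fintype ι]

/-- The skew-product map `S_i(x,y) = (f_i x, g_i (x,y))`. -/
def Smap (f : ι → ℝ → ℝ) (g : ι → ℝ × ℝ → ℝ) (i : ι) : ℝ × ℝ → ℝ × ℝ :=
  fun a => (f i a.1, g i a)

/-- The composition `S_𝔦 = S_{i₁} ∘ ⋯ ∘ S_{i_k}` along a finite word `𝔦 = [i₁, …, i_k]`. -/
def Sword (f : ι → ℝ → ℝ) (g : ι → ℝ × ℝ → ℝ) : List ι → ℝ × ℝ → ℝ × ℝ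
  | [] => id
  | i :: l => Smap f g i ∘ Sword f g l

/-- The first component `f_𝔦 = f_{i₁} ∘ ⋯ ∘ f_{i_k}` of `S_𝔦` (a function of `x` only). -/
def fword (f : ι → ℝ → ℝ) : List ι → ℝ → ℝ
  | [] => id
  | i :: l => f i ∘ fword f l

/-- Top-left entry `f_{𝔦,x}(a)` of the (lower triangular) Jacobian `D_a S_𝔦`. -/
def fxw (f : ι → ℝ → ℝ) (g : ι → ℝ × ℝ → ℝ) (l : List ι) (a : ℝ × ℝ) : ℝ :=
  deriv (fun x => (Sword f g l (x, a.2)).1) a.1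

/-- Bottom-left entry `g_{𝔦,x}(a)` of the Jacobian `D_a S_𝔦`. -/
def gxw (f : ι → ℝ → ℝ) (g : ι → ℝ × ℝ → ℝ) (l : List ι) (a : ℝ × ℝ) : ℝ :=
  deriv (fun x => (Sword f g l (x, a.2)).2) a.1

/-- Bottom-right entry `g_{𝔦,y}(a)` of the Jacobian `D_a S_𝔦`. -/
def gyw (f : ι → ℝ → ℝ) (g : ι → ℝ × ℝ → ℝ) (l : List ι) (a : ℝ × ℝ) : ℝ :=
  deriv (fun y => (Sword f g l (a.1, y)).2) a.2

/-- The standing hypotheses: `|𝓘| ≥ 2`; each `S_i(x,y) = (f_i x, g_i(x,y))` maps the unit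
square into itself; `f_i, g_i` are `C^{1+α}` contractions (`0 < α ≤ 1`); and the
domination condition `inf f_{i,x} > sup g_{i,y} ≥ inf g_{i,y} ≥ d > 0` holds. -/
structure IFSHyp (f : ι → ℝ → ℝ) (g : ι → ℝ × ℝ → ℝ) (α d : ℝ) : Prop where
  card2 : 2 ≤ Fintype.card ι
  alpha_pos : 0 < α
  alpha_le_one : α ≤ 1
  d_pos : 0 < d
  maps_f : ∀ i, Set.MapsTo (f i) (Set.Icc 0 1) (Set.Icc 0 1)
  maps_g : ∀ i, Set.MapsTo (g i) unitSq (Set.Icc 0 1)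
  diff_f : ∀ i, Differentiable ℝ (f i)
  diff_g : ∀ i, Differentiable ℝ (g i)
  holder_f : ∀ i, ∃ H : ℝ, ∀ x ∈ Set.Icc (0:ℝ) 1, ∀ y ∈ Set.Icc (0:ℝ) 1,
      |deriv (f i) x - deriv (f i) y| ≤ H * |x - y| ^ α
  holder_g : ∀ i, ∃ H : ℝ, ∀ a ∈ unitSq, ∀ b ∈ unitSq,
      ‖fderiv ℝ (g i) a - fderiv ℝ (g i) b‖ ≤ H * ‖a - b‖ ^ α
  contr_f : ∀ i, ∃ c, 0 ≤ c ∧ c < 1 ∧ ∀ x ∈ Set.Icc (0:ℝ) 1, ∀ y ∈ Set.Icc (0:ℝ) 1,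
      |f i x - f i y| ≤ c * |x - y|
  contr_g : ∀ i, ∃ c, 0 ≤ c ∧ c < 1 ∧ ∀ a ∈ unitSq, ∀ b ∈ unitSq,
      |g i a - g i b| ≤ c * ‖a - b‖
  dom : ∀ i, sSup (gyw f g [i] '' unitSq) < sInf (fxw f g [i] '' unitSq)
  dom_d : ∀ i, ∀ a ∈ unitSq, d ≤ gyw f g [i] a

/-- The larger singular value of the lower triangular matrix `A = [[a,0],[b,c]]`, i.e. the
square root of the larger eigenvalue of `AᵀA`, in explicit closed form. -/
def sv1 (a b c : ℝ) : ℝ :=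
  Real.sqrt (((a ^ 2 + b ^ 2 + c ^ 2) +
    Real.sqrt ((a ^ 2 + b ^ 2 + c ^ 2) ^ 2 - 4 * (a * c) ^ 2)) / 2)

/-- The smaller singular value of the lower triangular matrix `A = [[a,0],[b,c]]`, i.e. the
square root of the smaller eigenvalue of `AᵀA`, in explicit closed form. -/
def sv2 (a b c : ℝ) : ℝ :=
  Real.sqrt (((a ^ 2 + b ^ 2 + c ^ 2) -
    Real.sqrt ((a ^ 2 + b ^ 2 + c ^ 2) ^ 2 - 4 * (a * c) ^ 2)) / 2)

/-- `α₁(D_a S_𝔦)`, the larger singular value of the Jacobian. -/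
def alphaOne (f : ι → ℝ → ℝ) (g : ι → ℝ × ℝ → ℝ) (l : List ι) (a : ℝ × ℝ) : ℝ :=
  sv1 (fxw f g l a) (gxw f g l a) (gyw f g l a)

/-- `α₂(D_a S_𝔦)`, the smaller singular value of the Jacobian. -/
def alphaTwo (f : ι → ℝ → ℝ) (g : ι → ℝ × ℝ → ℝ) (l : List ι) (a : ℝ × ℝ) : ℝ :=
  sv2 (fxw f g l a) (gxw f g l a) (gyw f g l a)

/-- `η = sup_{i, a, b} g_{i,y}(a) / f_{i,x}(b)`. -/
def etaSup (f : ι → ℝ → ℝ) (g : ι → ℝ × ℝ → ℝ) : ℝ :=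
  sSup {x : ℝ | ∃ i : ι, ∃ a ∈ unitSq, ∃ b ∈ unitSq, x = gyw f g [i] a / fxw f g [i] b}

/-- `p(𝔦) = p_{i₁} ⋯ p_{i_k}`. -/
def pword (p : ι → ℝ) (l : List ι) : ℝ := (l.map p).prod

/-- `(p_i)` is a probability vector with all entries in `(0,1)`. -/
def ProbVec (p : ι → ℝ) : Prop := (∀ i, 0 < p i ∧ p i < 1) ∧ ∑ i, p i = 1

/-- The `q`-modified singular value function
`ψ^{s,q}_a(𝔦) = p(𝔦)^q α₁(D_aS_𝔦)^βq α₂(D_aS_𝔦)^(s−βq)` (real exponents). -/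
def psiSV (f : ι → ℝ → ℝ) (g : ι → ℝ × ℝ → ℝ) (p : ι → ℝ) (s q βq : ℝ)
    (a : ℝ × ℝ) (l : List ι) : ℝ :=
  pword p l ^ q * alphaOne f g l a ^ βq * alphaTwo f g l a ^ (s - βq)

/-- `Ψ^{s,q}_{a,k} = Σ_{𝔦 ∈ 𝓘^k} ψ^{s,q}_a(𝔦)`. -/
def PsiSum (f : ι → ℝ → ℝ) (g : ι → ℝ × ℝ → ℝ) (p : ι → ℝ) (s q βq : ℝ)
    (a : ℝ × ℝ) (k : ℕ) : ℝ :=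
  ∑ w : Fin k → ι, psiSV f g p s q βq a (List.ofFn w)

/-- The `δ`-stopping `𝓘_{a,δ} = {𝔦 : α₂(D_aS_𝔦) < δ ≤ α₂(D_aS_𝔦̂)}`, where `𝔦̂` drops the
last letter of `𝔦`. -/
def stopping (f : ι → ℝ → ℝ) (g : ι → ℝ × ℝ → ℝ) (a : ℝ × ℝ) (δ : ℝ) : Set (List ι) :=
  {l | l ≠ [] ∧ alphaTwo f g l a < δ ∧ δ ≤ alphaTwo f g l.dropLast a}

/-- `q`-th power moment sum of a measure on `ℝ` over the `δ`-mesh intervals of positive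
measure. -/
def msum1 (ν : Measure ℝ) (q δ : ℝ) : ℝ :=
  ∑' k : ℤ, if 0 < ν (Set.Icc ((k : ℝ) * δ) (((k : ℝ) + 1) * δ)) then
    (ν (Set.Icc ((k : ℝ) * δ) (((k : ℝ) + 1) * δ))).toReal ^ q else 0

/-- `q`-th power moment sum of a measure on `ℝ²` over the `δ`-mesh squares of positive
measure. -/
def msum2 (ν : Measure (ℝ × ℝ)) (q δ : ℝ) : ℝ :=
  ∑' k : ℤ × ℤ,
    if 0 < ν (Set.Icc ((k.1 : ℝ) * δ) (((k.1 : ℝ) + 1) * δ) ×ˢ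
        Set.Icc ((k.2 : ℝ) * δ) (((k.2 : ℝ) + 1) * δ)) then
      (ν (Set.Icc ((k.1 : ℝ) * δ) (((k.1 : ℝ) + 1) * δ) ×ˢ
        Set.Icc ((k.2 : ℝ) * δ) (((k.2 : ℝ) + 1) * δ))).toReal ^ q else 0

/-- Upper `L^q`-spectrum of a measure on `ℝ²`. -/
def upperTau2 (ν : Measure (ℝ × ℝ)) (q : ℝ) : ℝ :=
  limsup (fun δ => Real.log (msum2 ν q δ) / (-Real.log δ)) (𝓝[>] (0:ℝ))

/-- Lower `L^q`-spectrum of a measure on `ℝ²`. -/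
def lowerTau2 (ν : Measure (ℝ × ℝ)) (q : ℝ) : ℝ :=
  liminf (fun δ => Real.log (msum2 ν q δ) / (-Real.log δ)) (𝓝[>] (0:ℝ))

theorem fst_Sword {ι : Type*} (f : ι → ℝ → ℝ) (g : ι → ℝ × ℝ → ℝ) (l : List ι) (a : ℝ × ℝ) :
    (Sword f g l a).1 = fword f l a.1 := by
  induction l with
  | nil => rfl
  | cons i l ih => simp [Sword, Smap, fword, ih]

theorem ContinuousLinearMap.apply_prod_real (L : ℝ × ℝ →L[ℝ] ℝ) (u v : ℝ) :
    L (u, v) = u * L (1, 0) + v * L (0, 1) := by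
  have : ((u, v) : ℝ × ℝ) = u • ((1, 0) : ℝ × ℝ) + v • ((0, 1) : ℝ × ℝ) := by simp
  rw [this, map_add, map_smul, map_smul, smul_eq_mul, smul_eq_mul]

theorem gyw_singleton {ι : Type*} (f : ι → ℝ → ℝ) {g : ι → ℝ × ℝ → ℝ} {i : ι}
    (hg : Differentiable ℝ (g i)) (a : ℝ × ℝ) :
    gyw f g [i] a = fderiv ℝ (g i) a (0, 1) := by
  have hc : HasDerivAt (fun y : ℝ => (a.1, y)) ((0 : ℝ), (1 : ℝ)) a.2 :=
    (hasDerivAt_const a.2 a.1).prodMk (hasDerivAt_id a.2)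
  exact ((hg a).hasFDerivAt.comp_hasDerivAt_of_eq a.2 hc rfl).deriv

theorem zero_mem_unitSq : (0 : ℝ × ℝ) ∈ unitSq := ⟨by simp, by simp⟩

theorem norm_le_one_of_mem_unitSq {a : ℝ × ℝ} (ha : a ∈ unitSq) : ‖a‖ ≤ 1 := by
  obtain ⟨⟨h1, h2⟩, h3, h4⟩ := ha
  rw [Prod.norm_def, Real.norm_of_nonneg h1, Real.norm_of_nonneg h3]
  exact max_le h2 h4

/-- A Hölder-type bound on a subset of the unit ball containing the origin forces boundedness. -/
theorem exists_norm_le_of_holder {X E : Type*} [SeminormedAddCommGroup X]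
    [SeminormedAddCommGroup E] {s : Set X} (h0 : 0 ∈ s) (hs : ∀ a ∈ s, ‖a‖ ≤ 1) {F : X → E}
    {α : ℝ} (hα : 0 < α) (hF : ∃ H : ℝ, ∀ a ∈ s, ∀ b ∈ s, ‖F a - F b‖ ≤ H * ‖a - b‖ ^ α) :
    ∃ B : ℝ, ∀ a ∈ s, ‖F a‖ ≤ B := by
  obtain ⟨H, hH⟩ := hF
  refine ⟨‖F 0‖ + |H|, fun a ha => ?_⟩
  have hpow : ‖a - 0‖ ^ α ≤ 1 :=
    Real.rpow_le_one (norm_nonneg _) (by simpa using hs a ha) hα.le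
  have hdist : ‖F a - F 0‖ ≤ |H| :=
    calc ‖F a - F 0‖ ≤ H * ‖a - 0‖ ^ α := hH a ha 0 h0
      _ ≤ |H| * ‖a - 0‖ ^ α := by gcongr; exact le_abs_self H
      _ ≤ |H| := mul_le_of_le_one_right (abs_nonneg H) hpow
  linarith [norm_le_norm_add_norm_sub' (F a) (F 0)]

section Word

variable {ι : Type*} {f : ι → ℝ → ℝ} {g : ι → ℝ × ℝ → ℝ}

theorem differentiable_Sword (hf : ∀ i, Differentiable ℝ (f i)) (hg : ∀ i, Differentiable ℝ (g i))
    (l : List ι) : Differentiable ℝ (Sword f g l) := by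
  induction l with
  | nil => exact differentiable_id
  | cons i l ih =>
    exact (((hf i).comp differentiable_fst).prodMk (hg i)).comp ih

theorem mapsTo_Sword (hf : ∀ i, MapsTo (f i) (Icc 0 1) (Icc 0 1))
    (hg : ∀ i, MapsTo (g i) unitSq (Icc 0 1)) (l : List ι) :
    MapsTo (Sword f g l) unitSq unitSq := by
  induction l with
  | nil => exact mapsTo_id _
  | cons i l ih => exact fun a ha => ⟨hf i (ih ha).1, hg i (ih ha)⟩

theorem hasDerivAt_Sword_left (hf : ∀ i, Differentiable ℝ (f i))
    (hg : ∀ i, Differentiable ℝ (g i)) (l : List ι) (a : ℝ × ℝ) :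
    HasDerivAt (fun x => Sword f g l (x, a.2)) (fxw f g l a, gxw f g l a) a.1 := by
  have hd : DifferentiableAt ℝ (fun x : ℝ => Sword f g l (x, a.2)) a.1 :=
    ((differentiable_Sword hf hg l).comp
      (differentiable_id.prodMk (differentiable_const a.2))).differentiableAt
  exact hd.fst.hasDerivAt.prodMk hd.snd.hasDerivAt

theorem hasDerivAt_Sword_right (hf : ∀ i, Differentiable ℝ (f i))
    (hg : ∀ i, Differentiable ℝ (g i)) (l : List ι) (a : ℝ × ℝ) :
    HasDerivAt (fun y => Sword f g l (a.1, y)) (0, gyw f g l a) a.2 := by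
  have hd : DifferentiableAt ℝ (fun y : ℝ => Sword f g l (a.1, y)) a.2 :=
    ((differentiable_Sword hf hg l).comp
      ((differentiable_const a.1).prodMk differentiable_id)).differentiableAt
  have hfst : HasDerivAt (fun y : ℝ => (Sword f g l (a.1, y)).1) 0 a.2 := by
    simp_rw [fst_Sword]
    exact hasDerivAt_const _ _
  exact hfst.prodMk hd.snd.hasDerivAt

theorem fxw_cons (hf : ∀ i, Differentiable ℝ (f i)) (hg : ∀ i, Differentiable ℝ (g i))
    (i : ι) (l : List ι) (a : ℝ × ℝ) :
    fxw f g (i :: l) a = fxw f g [i] (Sword f g l a) * fxw f g l a :=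
  (((hf i) (Sword f g l a).1).hasDerivAt.comp_of_eq a.1
    (hasDerivAt_Sword_left hf hg l a).fst rfl).deriv

theorem gxw_cons (hf : ∀ i, Differentiable ℝ (f i)) (hg : ∀ i, Differentiable ℝ (g i))
    (i : ι) (l : List ι) (a : ℝ × ℝ) :
    gxw f g (i :: l) a = fxw f g l a * fderiv ℝ (g i) (Sword f g l a) (1, 0) +
      gxw f g l a * gyw f g [i] (Sword f g l a) := by
  rw [gyw_singleton f (hg i), ← ContinuousLinearMap.apply_prod_real]
  exact ((hg i (Sword f g l a)).hasFDerivAt.comp_hasDerivAt_of_eq a.1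
    (hasDerivAt_Sword_left hf hg l a) rfl).deriv

theorem gyw_cons (hf : ∀ i, Differentiable ℝ (f i)) (hg : ∀ i, Differentiable ℝ (g i))
    (i : ι) (l : List ι) (a : ℝ × ℝ) :
    gyw f g (i :: l) a = gyw f g [i] (Sword f g l a) * gyw f g l a := by
  have h := ((hg i (Sword f g l a)).hasFDerivAt.comp_hasDerivAt_of_eq a.2
    (hasDerivAt_Sword_right hf hg l a) rfl).deriv
  rw [ContinuousLinearMap.apply_prod_real, zero_mul, zero_add, ← gyw_singleton f (hg i),
    mul_comm] at h
  exact h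

/-- Uniform bounds on the Jacobians of the generating maps propagate to all words: the diagonal
entries stay ordered and the off-diagonal entry is dominated by the top-left one. -/
theorem jacobian_bounds (hf : ∀ i, Differentiable ℝ (f i)) (hg : ∀ i, Differentiable ℝ (g i))
    (hmf : ∀ i, MapsTo (f i) (Icc 0 1) (Icc 0 1)) (hmg : ∀ i, MapsTo (g i) unitSq (Icc 0 1))
    {B M m : ι → ℝ} {R : ℝ} (hR : 0 ≤ R) (hRB : ∀ i, B i + M i * R ≤ m i * R)
    (hgx : ∀ i, ∀ a ∈ unitSq, |fderiv ℝ (g i) a (1, 0)| ≤ B i)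
    (hgy : ∀ i, ∀ a ∈ unitSq, gyw f g [i] a ≤ M i) (hgy0 : ∀ i, ∀ a ∈ unitSq, 0 < gyw f g [i] a)
    (hfx : ∀ i, ∀ a ∈ unitSq, m i ≤ fxw f g [i] a) (hMm : ∀ i, M i < m i)
    (l : List ι) {a : ℝ × ℝ} (ha : a ∈ unitSq) :
    0 < fxw f g l a ∧ 0 ≤ gyw f g l a ∧ gyw f g l a ≤ fxw f g l a ∧
      |gxw f g l a| ≤ R * fxw f g l a := by
  induction l with
  | nil =>
    have h1 : fxw f g [] a = 1 := deriv_id a.1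
    have h2 : gyw f g [] a = 1 := deriv_id a.2
    have h3 : gxw f g [] a = 0 := deriv_const a.1 a.2
    simp [h1, h2, h3, hR]
  | cons i l ih =>
    obtain ⟨hF, hG, hGF, hX⟩ := ih
    have hp := mapsTo_Sword hmf hmg l ha
    rw [fxw_cons hf hg, gyw_cons hf hg, gxw_cons hf hg]
    set p := Sword f g l a
    have h1 := hgx i p hp
    have h2 := hgy i p hp
    have h3 := hgy0 i p hp
    have h4 := hfx i p hp
    have hM := hMm i
    have hfp : 0 < fxw f g [i] p := by linarith
    refine ⟨mul_pos hfp hF, mul_nonneg h3.le hG, mul_le_mul (by linarith) hGF hG hfp.le, ?_⟩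
    calc |fxw f g l a * fderiv ℝ (g i) p (1, 0) + gxw f g l a * gyw f g [i] p|
        ≤ fxw f g l a * |fderiv ℝ (g i) p (1, 0)| + |gxw f g l a| * gyw f g [i] p := by
          refine (abs_add_le _ _).trans_eq ?_
          rw [abs_mul, abs_mul, abs_of_pos hF, abs_of_pos h3]
      _ ≤ fxw f g l a * B i + (R * fxw f g l a) * M i := by gcongr
      _ = fxw f g l a * (B i + M i * R) := by ring
      _ ≤ fxw f g l a * (fxw f g [i] p * R) := by
          gcongr
          exact (hRB i).trans (by gcongr)
      _ = R * (fxw f g [i] p * fxw f g l a) := by ring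

end Word

theorem sv1_comparable {a b c R : ℝ} (ha : 0 ≤ a) (hc : 0 ≤ c) (hca : c ≤ a) (hR : 0 ≤ R)
    (hb : |b| ≤ R * a) : (2 + R)⁻¹ * a ≤ sv1 a b c ∧ sv1 a b c ≤ (2 + R) * a := by
  set T := a ^ 2 + b ^ 2 + c ^ 2 with hT
  have hT0 : 0 ≤ T := by positivity
  have hs0 := Real.sqrt_nonneg (T ^ 2 - 4 * (a * c) ^ 2)
  have hs1 : √(T ^ 2 - 4 * (a * c) ^ 2) ≤ T :=
    Real.sqrt_le_iff.2 ⟨hT0, by linarith [sq_nonneg (a * c)]⟩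
  have hb2 : b ^ 2 ≤ (R * a) ^ 2 := sq_le_sq' (abs_le.1 hb).1 (abs_le.1 hb).2
  have hc2 : c ^ 2 ≤ a ^ 2 := by gcongr
  constructor
  · have hhalf : (2 + R)⁻¹ * a ≤ 2⁻¹ * a := by gcongr; linarith
    refine hhalf.trans (Real.le_sqrt_of_sq_le ?_)
    nlinarith [sq_nonneg a, sq_nonneg b, sq_nonneg c]
  · refine Real.sqrt_le_iff.2 ⟨by positivity, ?_⟩
    have : 0 ≤ R * a ^ 2 := by positivity
    nlinarith [sq_nonneg a]

theorem alphaOne_comparable_fxw {ι : Type*} [Fintype ι]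
    (f : ι → ℝ → ℝ) (g : ι → ℝ × ℝ → ℝ) (α d : ℝ) (h : IFSHyp f g α d) :
    ∃ C : ℝ, 1 ≤ C ∧ ∀ l : List ι, l ≠ [] → ∀ a ∈ unitSq,
      C⁻¹ * fxw f g l a ≤ alphaOne f g l a ∧ alphaOne f g l a ≤ C * fxw f g l a := by
  choose B hB using fun i => exists_norm_le_of_holder zero_mem_unitSq
    (fun a => norm_le_one_of_mem_unitSq) h.alpha_pos (h.holder_g i)
  choose K hK using fun i => exists_norm_le_of_holder (s := Icc (0 : ℝ) 1)
    (F := deriv (f i)) (by simp)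
    (fun x hx => by rw [Real.norm_of_nonneg hx.1]; exact hx.2) h.alpha_pos (h.holder_f i)
  have happly : ∀ i, ∀ a ∈ unitSq, ∀ v : ℝ × ℝ, ‖v‖ = 1 → |fderiv ℝ (g i) a v| ≤ B i :=
    fun i a ha v hv => ((fderiv ℝ (g i) a).le_opNorm v).trans (by simpa [hv] using hB i a ha)
  have hbelow : ∀ i, BddBelow (fxw f g [i] '' unitSq) := by
    refine fun i => ⟨-K i, ?_⟩
    rintro _ ⟨a, ha, rfl⟩
    exact (abs_le.1 (hK i a.1 ha.1)).1
  have habove : ∀ i, BddAbove (gyw f g [i] '' unitSq) := by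
    refine fun i => ⟨B i, ?_⟩
    rintro _ ⟨a, ha, rfl⟩
    rw [gyw_singleton f (h.diff_g i)]
    exact (le_abs_self _).trans (happly i a ha _ (by simp [Prod.norm_def]))
  set M : ι → ℝ := fun i => sSup (gyw f g [i] '' unitSq)
  set m : ι → ℝ := fun i => sInf (fxw f g [i] '' unitSq)
  have hMm : ∀ i, M i < m i := h.dom
  have hB0 : ∀ i, 0 ≤ B i := fun i =>
    (norm_nonneg _).trans (hB i 0 zero_mem_unitSq)
  have hterm : ∀ i, 0 ≤ B i / (m i - M i) := fun i =>
    div_nonneg (hB0 i) (sub_pos.2 (hMm i)).le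
  set R := ∑ i, B i / (m i - M i)
  have hR : 0 ≤ R := Finset.sum_nonneg fun i _ => hterm i
  have hRB : ∀ i, B i + M i * R ≤ m i * R := by
    intro i
    have hle : B i / (m i - M i) ≤ R :=
      Finset.single_le_sum (fun j _ => hterm j) (Finset.mem_univ i)
    rw [div_le_iff₀ (sub_pos.2 (hMm i))] at hle
    linarith
  refine ⟨2 + R, by linarith, fun l _ a ha => ?_⟩
  obtain ⟨hF, hG, hGF, hX⟩ := jacobian_bounds h.diff_f h.diff_g h.maps_f h.maps_g hR hRB
    (fun i a ha => happly i a ha _ (by simp [Prod.norm_def]))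
    (fun i a ha => le_csSup (habove i) (mem_image_of_mem _ ha))
    (fun i a ha => h.d_pos.trans_le (h.dom_d i a ha))
    (fun i a ha => csInf_le (hbelow i) (mem_image_of_mem _ ha)) hMm l ha
  exact sv1_comparable hF.le hG hGF hR hX

end
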